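/- Let A and B be self-adjoint operators on a Hilbert space H such that A + B is essentially self-adjoint on D(A) ∩ D(B). Then for every f ∈ H and every t ∈ ℝ, the Trotter product formula holds: lim_{n→∞} (e^{itA/n} e^{itB/n})^n f = e^{it·closure(A+B)} f. -/

import Mathlib

open Filter Topology Set

section TrotterAux

variable {H : Type*} [NormedAddCommGroup H] [InnerProductSpace ℂ H]

theorem trot_pow_norm (F : H →L[ℂ] H) (hF : ∀ x, ‖F x‖ = ‖x‖) (m : ℕ) (f : H) :
    ‖(F ^ m) f‖ = ‖f‖ := by
  induction m with
  | zero => simp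
  | succ m ih => rw [pow_succ', mul_apply_eq_comp, hF, ih]

theorem trot_step (F F' : H →L[ℂ] H)
    (hadj : ∀ x y, inner ℂ (F' x) y = inner ℂ x (F y)) (m : ℕ) (f y : H) :
    inner ℂ y ((F ^ (m + 1)) f) = inner ℂ y ((F ^ m) f) + inner ℂ (F' y - y) ((F ^ m) f) := by
  rw [inner_sub_left, hadj, pow_succ', mul_apply_eq_comp]
  ring

theorem trot_L1 (F F' : H →L[ℂ] H) (hF : ∀ x, ‖F x‖ = ‖x‖)
    (hadj : ∀ x y, inner ℂ (F' x) y = inner ℂ x (F y)) (m : ℕ) (f y : H) :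
    ‖inner ℂ y ((F ^ m) f) - inner ℂ y f‖ ≤ m * ‖F' y - y‖ * ‖f‖ := by
  induction m with
  | zero => simp
  | succ m ih =>
    rw [trot_step F F' hadj, add_sub_right_comm]
    refine (norm_add_le _ _).trans ?_
    have h := norm_inner_le_norm (𝕜 := ℂ) (F' y - y) ((F ^ m) f)
    rw [trot_pow_norm F hF] at h
    rw [Nat.cast_add_one]
    linarith

theorem trot_L2 (F F' : H →L[ℂ] H) (hF : ∀ x, ‖F x‖ = ‖x‖)
    (hadj : ∀ x y, inner ℂ (F' x) y = inner ℂ x (F y)) (N : ℕ) (f g z y : H) (m : ℕ) (hm : m ≤ N) :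
    ‖inner ℂ g ((F ^ m) f) - inner ℂ g f - m * inner ℂ z f‖
      ≤ m * (‖F' g - g - z‖ + 2 * ‖z - y‖ + N * ‖F' y - y‖) * ‖f‖ := by
  induction m with
  | zero => simp
  | succ m ih =>
    have ih := ih (by omega)
    have e : inner ℂ g ((F ^ (m + 1)) f) - inner ℂ g f - ((m + 1 : ℕ) : ℂ) * inner ℂ z f
      = (inner ℂ g ((F ^ m) f) - inner ℂ g f - m * inner ℂ z f)
        + (inner ℂ (F' g - g - z) ((F ^ m) f) + inner ℂ (z - y) ((F ^ m) f - f)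
        + (inner ℂ y ((F ^ m) f) - inner ℂ y f)) := by
      rw [trot_step F F' hadj]
      simp only [inner_sub_left, inner_sub_right]
      push_cast
      ring
    rw [e]
    have h1 := norm_inner_le_norm (𝕜 := ℂ) (F' g - g - z) ((F ^ m) f)
    rw [trot_pow_norm F hF] at h1
    have h2 := norm_inner_le_norm (𝕜 := ℂ) (z - y) ((F ^ m) f - f)
    have h2' : ‖(F ^ m) f - f‖ ≤ 2 * ‖f‖ := by
      refine (norm_sub_le _ _).trans ?_
      rw [trot_pow_norm F hF]; linarith
    have h2'' := mul_le_mul_of_nonneg_left h2' (norm_nonneg (z - y))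
    have h3 := trot_L1 F F' hF hadj m f y
    have h3' : (m : ℝ) * ‖F' y - y‖ * ‖f‖ ≤ N * ‖F' y - y‖ * ‖f‖ := by
      have : (m : ℝ) ≤ N := by exact_mod_cast (by omega : m ≤ N)
      gcongr
    refine (norm_add_le _ _).trans ?_
    refine (add_le_add ih ((norm_add_le _ _).trans (add_le_add (norm_add_le _ _) le_rfl))).trans ?_
    rw [Nat.cast_add_one]
    linarith

/-- rescaled version -/
theorem trot_L2n (F F' : H →L[ℂ] H) (hF : ∀ x, ‖F x‖ = ‖x‖)
    (hadj : ∀ x y, inner ℂ (F' x) y = inner ℂ x (F y)) (n : ℕ) (hn : 0 < n) (f g k y : H)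
    (j m : ℕ) :
    ‖inner ℂ g ((F ^ (m + j)) f) - inner ℂ g ((F ^ j) f)
        - ((m / n : ℝ) : ℂ) * inner ℂ k ((F ^ j) f)‖
      ≤ (m / n : ℝ) * (‖(n : ℝ) • (F' g - g) - k‖ + 2 * ‖k - y‖
        + (m / n : ℝ) * ‖(n : ℝ) • (F' y - y)‖) * ‖f‖ := by
  have hn' : (n : ℝ) ≠ 0 := by positivity
  have h := trot_L2 F F' hF hadj m ((F ^ j) f) g ((n : ℝ)⁻¹ • k) ((n : ℝ)⁻¹ • y) m le_rfl
  rw [trot_pow_norm F hF, ← mul_apply_eq_comp, ← pow_add] at h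
  have e1 : (m : ℂ) * inner ℂ ((n : ℝ)⁻¹ • k) ((F ^ j) f)
      = ((m / n : ℝ) : ℂ) * inner ℂ k ((F ^ j) f) := by
    rw [inner_smul_left_eq_smul, Complex.real_smul]
    push_cast
    ring
  have e2 : ‖F' g - g - (n : ℝ)⁻¹ • k‖ = (n : ℝ)⁻¹ * ‖(n : ℝ) • (F' g - g) - k‖ := by
    have : F' g - g - (n : ℝ)⁻¹ • k = (n : ℝ)⁻¹ • ((n : ℝ) • (F' g - g) - k) := by
      rw [smul_sub (n : ℝ)⁻¹, smul_smul, inv_mul_cancel₀ hn', one_smul]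
    rw [this, norm_smul]; simp
  have e3 : ‖(n : ℝ)⁻¹ • k - (n : ℝ)⁻¹ • y‖ = (n : ℝ)⁻¹ * ‖k - y‖ := by
    rw [← smul_sub, norm_smul]; simp
  have e4 : ‖F' ((n : ℝ)⁻¹ • y) - (n : ℝ)⁻¹ • y‖ = (n : ℝ)⁻¹ * ((n : ℝ)⁻¹ * ‖(n : ℝ) • (F' y - y)‖) := by
    have : F' ((n : ℝ)⁻¹ • y) = (n : ℝ)⁻¹ • F' y := by
      exact map_real_smul F' F'.continuous _ _
    rw [this, ← smul_sub, norm_smul, norm_smul]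
    simp [inv_mul_cancel_left₀ hn']
  rw [e1, e2, e3, e4] at h
  refine h.trans (le_of_eq ?_)
  field_simp

theorem trot_L1n (F F' : H →L[ℂ] H) (hF : ∀ x, ‖F x‖ = ‖x‖)
    (hadj : ∀ x y, inner ℂ (F' x) y = inner ℂ x (F y)) (n : ℕ) (hn : 0 < n) (f g : H)
    (j m : ℕ) :
    ‖inner ℂ g ((F ^ (m + j)) f) - inner ℂ g ((F ^ j) f)‖
      ≤ (m / n : ℝ) * ‖(n : ℝ) • (F' g - g)‖ * ‖f‖ := by
  have hn' : (n : ℝ) ≠ 0 := by positivity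
  have h := trot_L1 F F' hF hadj m ((F ^ j) f) g
  rw [trot_pow_norm F hF, ← mul_apply_eq_comp, ← pow_add] at h
  refine h.trans (le_of_eq ?_)
  rw [norm_smul, Real.norm_natCast]
  field_simp

theorem trot_floor {r s : ℝ} (hr : 0 ≤ r) (hrs : r ≤ s) :
    Tendsto (fun n : ℕ => (((⌊s * n⌋₊ - ⌊r * n⌋₊ : ℕ) : ℝ) / n)) atTop (𝓝 (s - r)) := by
  have h1 := (tendsto_nat_floor_mul_div_atTop (R := ℝ) (hr.trans hrs)).comp
    tendsto_natCast_atTop_atTop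
  have h2 := (tendsto_nat_floor_mul_div_atTop (R := ℝ) hr).comp
    tendsto_natCast_atTop_atTop
  refine (h1.sub h2).congr fun n => ?_
  have : ⌊r * n⌋₊ ≤ ⌊s * n⌋₊ := Nat.floor_mono (by gcongr)
  simp only [Function.comp]
  rw [Nat.cast_sub this]
  ring

theorem trot_core (F F' : ℕ → H →L[ℂ] H) (hF : ∀ n x, ‖F n x‖ = ‖x‖)
    (hadj : ∀ n x y, inner ℂ (F' n x) y = inner ℂ x (F n y)) (S : Set (H × H))
    (hS : ∀ p ∈ S, Tendsto (fun n : ℕ => (n : ℝ) • (F' n p.1 - p.1)) atTop (𝓝 p.2))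
    (hd : Dense (Prod.fst '' S)) (x x' : ℝ → H) (hx : ∀ s, HasDerivAt x (x' s) s)
    (hmem : ∀ s, (x s, -x' s) ∈ closure S) (f : H) :
    Tendsto (fun n => inner ℂ (x 1) ((F n ^ n) f)) atTop (𝓝 (inner ℂ (x 0) f)) := by
  rw [tendsto_iff_ultrafilter]
  intro 𝒰 h𝒰
  have hex : ∀ (s : ℝ) (g : H), ∃ c : ℂ,
      Tendsto (fun n : ℕ => inner ℂ g ((F n ^ ⌊s * n⌋₊) f)) 𝒰 (𝓝 c) := by
    intro s g
    obtain ⟨c, -, hc⟩ := (isCompact_closedBall (0 : ℂ) (‖g‖ * ‖f‖)).ultrafilter_le_nhds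
      (𝒰.map (fun n : ℕ => inner ℂ g ((F n ^ ⌊s * n⌋₊) f))) (by
        rw [le_principal_iff]
        refine Ultrafilter.mem_map.2 (Filter.univ_mem' fun n => ?_)
        have h1 := norm_inner_le_norm (𝕜 := ℂ) g ((F n ^ ⌊s * n⌋₊) f)
        rw [trot_pow_norm _ (hF n)] at h1
        simpa using h1)
    exact ⟨c, hc⟩
  choose w hw using hex
  have wsub : ∀ s g h, w s (g - h) = w s g - w s h := fun s g h =>
    tendsto_nhds_unique (hw s (g - h)) (((hw s g).sub (hw s h)).congr fun n => by
      rw [inner_sub_left])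
  have wsmul : ∀ s (c : ℝ) g, w s (c • g) = c * w s g := fun s c g =>
    tendsto_nhds_unique (hw s (c • g)) (((hw s g).const_mul (c : ℂ)).congr fun n => by
      rw [inner_smul_left_eq_smul, Complex.real_smul])
  have wneg : ∀ s g, w s (-g) = - w s g := fun s g => by
    have := wsmul s (-1) g
    simpa using this
  have wbd : ∀ s g, ‖w s g‖ ≤ ‖g‖ * ‖f‖ := fun s g =>
    le_of_tendsto (hw s g).norm (Eventually.of_forall fun n => by
      have h1 := norm_inner_le_norm (𝕜 := ℂ) g ((F n ^ ⌊s * n⌋₊) f)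
      rwa [trot_pow_norm _ (hF n)] at h1)
  have wcont : ∀ s, Continuous (w s) := fun s => by
    refine (LipschitzWith.of_dist_le_mul (K := ‖f‖₊) fun g h => ?_).continuous
    rw [dist_eq_norm, dist_eq_norm, ← wsub, mul_comm]
    exact wbd s _
  have W1 : ∀ p ∈ S, ∀ r s : ℝ, 0 ≤ r → r ≤ s →
      ‖w s p.1 - w r p.1‖ ≤ (s - r) * ‖p.2‖ * ‖f‖ := by
    intro p hp r s hr hrs
    have hfl := (trot_floor hr hrs).mono_left h𝒰
    refine le_of_tendsto_of_tendsto ((hw s p.1).sub (hw r p.1)).norm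
      ((hfl.mul ((hS p hp).mono_left h𝒰).norm).mul_const _) ?_
    have hpos : ∀ᶠ n : ℕ in (𝒰 : Filter ℕ), 0 < n := h𝒰 (eventually_gt_atTop 0)
    filter_upwards [hpos] with n hn
    have := trot_L1n (F n) (F' n) (hF n) (hadj n) n hn f p.1 ⌊r * n⌋₊ (⌊s * n⌋₊ - ⌊r * n⌋₊)
    have hle : ⌊r * n⌋₊ ≤ ⌊s * n⌋₊ := Nat.floor_mono (by gcongr)
    rwa [Nat.sub_add_cancel hle] at this
  have W2 : ∀ p ∈ S, ∀ q ∈ S, ∀ r s : ℝ, 0 ≤ r → r ≤ s →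
      ‖w s p.1 - w r p.1 - ((s - r : ℝ) : ℂ) * w r p.2‖
        ≤ (s - r) * (2 * ‖p.2 - q.1‖ + (s - r) * ‖q.2‖) * ‖f‖ := by
    intro p hp q hq r s hr hrs
    have hfl := (trot_floor hr hrs).mono_left h𝒰
    have hflc := (Complex.continuous_ofReal.tendsto _).comp hfl
    have hp' : Tendsto (fun n : ℕ => (n : ℝ) • (F' n p.1 - p.1) - p.2) 𝒰 (𝓝 0) := by
      simpa using ((hS p hp).mono_left h𝒰).sub_const p.2
    have hR := (hfl.mul ((hp'.norm.add_const (2 * ‖p.2 - q.1‖)).add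
      (hfl.mul ((hS q hq).mono_left h𝒰).norm))).mul_const ‖f‖
    rw [norm_zero, zero_add] at hR
    refine le_of_tendsto_of_tendsto
      (((hw s p.1).sub (hw r p.1)).sub (hflc.mul (hw r p.2))).norm hR ?_
    have hpos : ∀ᶠ n : ℕ in (𝒰 : Filter ℕ), 0 < n := h𝒰 (eventually_gt_atTop 0)
    filter_upwards [hpos] with n hn
    have := trot_L2n (F n) (F' n) (hF n) (hadj n) n hn f p.1 p.2 q.1
      ⌊r * n⌋₊ (⌊s * n⌋₊ - ⌊r * n⌋₊)
    have hle : ⌊r * n⌋₊ ≤ ⌊s * n⌋₊ := Nat.floor_mono (by gcongr)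
    rwa [Nat.sub_add_cancel hle] at this
  have W1c : ∀ p ∈ closure S, ∀ r s : ℝ, 0 ≤ r → r ≤ s →
      ‖w s p.1 - w r p.1‖ ≤ (s - r) * ‖p.2‖ * ‖f‖ := by
    intro p hp r s hr hrs
    have hc : IsClosed {p : H × H | ‖w s p.1 - w r p.1‖ ≤ (s - r) * ‖p.2‖ * ‖f‖} :=
      isClosed_le ((((wcont s).comp continuous_fst).sub ((wcont r).comp continuous_fst)).norm)
        (by fun_prop)
    exact closure_minimal (fun p hp => W1 p hp r s hr hrs) hc hp
  have W2c : ∀ p ∈ closure S, ∀ q ∈ S, ∀ r s : ℝ, 0 ≤ r → r ≤ s →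
      ‖w s p.1 - w r p.1 - ((s - r : ℝ) : ℂ) * w r p.2‖
        ≤ (s - r) * (2 * ‖p.2 - q.1‖ + (s - r) * ‖q.2‖) * ‖f‖ := by
    intro p hp q hq r s hr hrs
    have hc : IsClosed {p : H × H | ‖w s p.1 - w r p.1 - ((s - r : ℝ) : ℂ) * w r p.2‖
        ≤ (s - r) * (2 * ‖p.2 - q.1‖ + (s - r) * ‖q.2‖) * ‖f‖} :=
      isClosed_le ((((wcont s).comp continuous_fst).sub ((wcont r).comp continuous_fst)).sub
        (continuous_const.mul ((wcont r).comp continuous_snd))).norm (by fun_prop)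
    exact closure_minimal (fun p hp => W2 p hp q hq r s hr hrs) hc hp
  have W1abs : ∀ r s : ℝ, 0 ≤ r → 0 ≤ s →
      ‖w s (x r) - w r (x r)‖ ≤ |s - r| * ‖x' r‖ * ‖f‖ := by
    intro r s hr hs
    rcases le_total r s with h | h
    · have := W1c _ (hmem r) r s hr h
      rwa [norm_neg, ← abs_of_nonneg (sub_nonneg.2 h)] at this
    · have := W1c _ (hmem r) s r hs h
      rwa [norm_neg, ← abs_of_nonneg (sub_nonneg.2 h), abs_sub_comm, norm_sub_rev] at this
  have hcont : ContinuousOn (fun s => w s (x s)) (Icc 0 1) := by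
    intro r hr
    have hb : Tendsto (fun s => ‖x s - x r‖ * ‖f‖ + |s - r| * ‖x' r‖ * ‖f‖) (𝓝[Icc 0 1] r)
        (𝓝 0) := by
      have hxc : ContinuousAt x r := (hx r).continuousAt
      have : ContinuousAt (fun s => ‖x s - x r‖ * ‖f‖ + |s - r| * ‖x' r‖ * ‖f‖) r := by
        fun_prop
      have := this.tendsto
      simp only [sub_self, norm_zero, abs_zero, zero_mul, add_zero] at this
      exact this.mono_left nhdsWithin_le_nhds
    rw [ContinuousWithinAt, tendsto_iff_norm_sub_tendsto_zero]
    refine squeeze_zero' (Eventually.of_forall fun _ => norm_nonneg _) ?_ hb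
    filter_upwards [self_mem_nhdsWithin] with s hs
    have e : w s (x s) - w r (x r) = w s (x s - x r) + (w s (x r) - w r (x r)) := by
      rw [wsub]; ring
    rw [e]
    exact (norm_add_le _ _).trans (add_le_add (wbd _ _) (W1abs r s hr.1 hs.1))
  have hder : ∀ r ∈ Ico (0 : ℝ) 1, HasDerivWithinAt (fun s => w s (x s)) 0 (Ici r) r := by
    intro r hr
    rw [hasDerivWithinAt_iff_isLittleO, Asymptotics.isLittleO_iff]
    intro c hc
    -- choose parameters
    obtain ⟨ε, hε, hεc⟩ : ∃ ε > 0, 6 * ε * ‖f‖ ≤ c := by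
      refine ⟨c / (6 * (‖f‖ + 1)), by positivity, ?_⟩
      have h0 := norm_nonneg f
      rw [mul_div_assoc', div_mul_eq_mul_div, div_le_iff₀ (by positivity)]
      nlinarith
    obtain ⟨_, ⟨q, hq, rfl⟩, hqd⟩ := Metric.mem_closure_iff.1 (hd (-x' r)) (ε / 2) (by positivity)
    rw [dist_eq_norm] at hqd
    have hlin := (Asymptotics.isLittleO_iff.1
      (hasDerivAt_iff_isLittleO.1 (hx r)) hε).filter_mono (nhdsWithin_le_nhds (s := Ici r))
    have hsm : ∀ᶠ s in 𝓝[Ici r] r, (s - r) * ‖q.2‖ < ε := by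
      have : ContinuousAt (fun s => (s - r) * ‖q.2‖) r := by fun_prop
      have := this.tendsto
      simp only [sub_self, zero_mul] at this
      exact (this.mono_left nhdsWithin_le_nhds).eventually_lt_const hε
    filter_upwards [hlin, hsm, self_mem_nhdsWithin] with s h1 h2 h3
    have hrs : r ≤ s := h3
    have hsr : 0 ≤ s - r := sub_nonneg.2 hrs
    have a1 := W2c _ (hmem r) q hq r s hr.1 hrs
    have a2 := W1 q hq r s hr.1 hrs
    have e : w s (x s) - w r (x r) - (s - r) • (0 : ℂ)
        = w s (x s - x r - (s - r) • x' r)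
          + (w s (x r) - w r (x r) - ((s - r : ℝ) : ℂ) * w r (-x' r))
          - ((s - r : ℝ) : ℂ) * ((w s (-x' r - q.1) - w r (-x' r - q.1))
            + (w s q.1 - w r q.1)) := by
      simp only [wsub, wsmul, wneg]
      simp
      ring
    rw [e, Real.norm_eq_abs, abs_of_nonneg hsr]
    rw [Real.norm_eq_abs, abs_of_nonneg hsr] at h1
    have b1 : ‖w s (x s - x r - (s - r) • x' r)‖ ≤ (s - r) * ε * ‖f‖ :=
      (wbd _ _).trans (by rw [mul_comm (s - r)]; gcongr)
    have b2 : ‖w s (x r) - w r (x r) - ((s - r : ℝ) : ℂ) * w r (-x' r)‖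
        ≤ (s - r) * (2 * ε) * ‖f‖ := by
      refine a1.trans ?_
      gcongr
      simp only
      linarith
    have b3 : ‖(w s (-x' r - q.1) - w r (-x' r - q.1)) + (w s q.1 - w r q.1)‖
        ≤ 3 * ε * ‖f‖ := by
      have c1 : ‖w s (-x' r - q.1)‖ ≤ ε * ‖f‖ := (wbd _ _).trans (by gcongr; linarith)
      have c2 : ‖w r (-x' r - q.1)‖ ≤ ε * ‖f‖ := (wbd _ _).trans (by gcongr; linarith)
      have c3 : ‖w s q.1 - w r q.1‖ ≤ ε * ‖f‖ := a2.trans (by gcongr)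
      refine (norm_add_le _ _).trans ((add_le_add (norm_sub_le _ _) c3).trans ?_)
      linarith
    have b3' : ‖((s - r : ℝ) : ℂ) * ((w s (-x' r - q.1) - w r (-x' r - q.1))
            + (w s q.1 - w r q.1))‖ ≤ (s - r) * (3 * ε * ‖f‖) := by
      rw [norm_mul, Complex.norm_real, Real.norm_eq_abs, abs_of_nonneg hsr]
      gcongr
    refine (norm_sub_le _ _).trans ((add_le_add ((norm_add_le _ _).trans
      (add_le_add b1 b2)) b3').trans ?_)
    have := mul_le_mul_of_nonneg_right hεc hsr
    linarith
  have key := constant_of_has_deriv_right_zero hcont hder 1 (by simp)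
  have h0 : w 0 (x 0) = inner ℂ (x 0) f :=
    tendsto_nhds_unique (hw 0 (x 0)) (by simp)
  have h1 := hw 1 (x 1)
  simp only [one_mul, Nat.floor_natCast] at h1
  rw [← h0, ← key]
  exact h1

end TrotterAux

section TrotterGroup

variable {H : Type*} [NormedAddCommGroup H] [InnerProductSpace ℂ H]

theorem trot_group_adj (U : ℝ → H →L[ℂ] H) (h0 : U 0 = 1)
    (hsg : ∀ s t : ℝ, U (s + t) = (U s).comp (U t)) (hiso : ∀ (t : ℝ) (v : H), ‖U t v‖ = ‖v‖)
    (s : ℝ) (x y : H) : inner ℂ (U (-s) x) y = inner ℂ x (U s y) := by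
  let L : H →ₗᵢ[ℂ] H := ⟨(U s : H →ₗ[ℂ] H), hiso s⟩
  have h := L.inner_map_map (U (-s) x) y
  have e : L (U (-s) x) = x := by
    change U s (U (-s) x) = x
    rw [← ContinuousLinearMap.comp_apply, ← hsg, add_neg_cancel, h0]
    rfl
  rw [e] at h
  exact h.symm

theorem trot_group_deriv (U : ℝ → H →L[ℂ] H)
    (hsg : ∀ s t : ℝ, U (s + t) = (U s).comp (U t))
    (x x' : H) (hx : HasDerivAt (fun t : ℝ => U t x) x' 0) (s : ℝ) :
    HasDerivAt (fun t : ℝ => U t x) (U s x') s := by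
  have h1 : HasDerivAt (fun τ : ℝ => U (τ - s) x) x' s := by
    have := HasDerivAt.comp_sub_const s s (f := fun t : ℝ => U t x) (f' := x') (by simpa using hx)
    exact this
  have h2 := ((U s).restrictScalars ℝ).hasFDerivAt.comp_hasDerivAt s h1
  refine h2.congr_of_eventuallyEq (Eventually.of_forall fun τ => ?_)
  change U τ x = U s (U (τ - s) x)
  rw [← ContinuousLinearMap.comp_apply, ← hsg, add_sub_cancel]

theorem trot_slope (φ : ℝ → H) (φ' : H) (h : HasDerivAt φ φ' 0) (t : ℝ) :
    Tendsto (fun n : ℕ => (n : ℝ) • (φ (-(t / n)) - φ 0)) atTop (𝓝 ((-t) • φ')) := by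
  have h1 : HasDerivAt (fun τ : ℝ => φ ((-t) * τ)) ((-t) • φ') 0 := by
    have hm : HasDerivAt (fun τ : ℝ => (-t) * τ) (-t) 0 := by
      simpa using (hasDerivAt_id (0 : ℝ)).const_mul (-t)
    exact HasDerivAt.scomp (0 : ℝ) (h := fun τ : ℝ => (-t) * τ) (by simpa using h) hm
  have h2 := h1.tendsto_slope_zero
  have h3 : Tendsto (fun n : ℕ => ((n : ℝ))⁻¹) atTop (𝓝[≠] 0) := by
    refine tendsto_nhdsWithin_iff.2 ⟨tendsto_inv_atTop_nhds_zero_nat, ?_⟩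
    filter_upwards [eventually_gt_atTop 0] with n hn
    have : (n : ℝ) ≠ 0 := by positivity
    simpa using this
  refine (h2.comp h3).congr fun n => ?_
  simp [div_eq_mul_inv]

theorem trot_prod (UA UB : ℝ → H →L[ℂ] H) (hUA0 : UA 0 = 1) (hUB0 : UB 0 = 1)
    (hUBiso : ∀ (t : ℝ) (v : H), ‖UB t v‖ = ‖v‖)
    (hUBcont : ∀ v : H, Continuous fun t => UB t v) (g a b : H)
    (ha : HasDerivAt (fun t : ℝ => UA t g) a 0) (hb : HasDerivAt (fun t : ℝ => UB t g) b 0)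
    (t : ℝ) :
    Tendsto (fun n : ℕ => (n : ℝ) • (((UB (-(t / n))).comp (UA (-(t / n)))) g - g)) atTop
      (𝓝 ((-t) • (a + b))) := by
  have h1 := trot_slope _ _ ha t
  have h2 := trot_slope _ _ hb t
  simp only [hUA0, hUB0, one_apply_eq_self] at h1 h2
  have h3 : Tendsto (fun n : ℕ => UB (-(t / n)) ((n : ℝ) • (UA (-(t / n)) g - g))) atTop
      (𝓝 ((-t) • a)) := by
    have hlim : Tendsto (fun n : ℕ => -(t / (n : ℝ))) atTop (𝓝 0) := by
      simpa using (tendsto_const_div_atTop_nhds_zero_nat t).neg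
    have h4 := ((hUBcont ((-t) • a)).tendsto 0).comp hlim
    simp only [hUB0, one_apply_eq_self] at h4
    have h5 : Tendsto (fun n : ℕ => UB (-(t / n)) ((n : ℝ) • (UA (-(t / n)) g - g) - (-t) • a))
        atTop (𝓝 0) := by
      rw [tendsto_zero_iff_norm_tendsto_zero]
      simp only [hUBiso]
      exact tendsto_iff_norm_sub_tendsto_zero.1 h1
    have h6 := h5.add h4
    rw [zero_add] at h6
    refine h6.congr fun n => ?_
    simp only [map_sub, Function.comp]
    abel
  have h7 := h3.add h2
  rw [← smul_add] at h7
  refine h7.congr fun n => ?_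
  have : UB (-(t / n)) ((n : ℝ) • (UA (-(t / n)) g - g))
      = (n : ℝ) • UB (-(t / n)) (UA (-(t / n)) g - g) :=
    map_real_smul (UB (-(t / n))) (UB (-(t / n))).continuous _ _
  rw [this, ← smul_add, map_sub, ContinuousLinearMap.comp_apply]
  congr 1
  abel

theorem trot_invariant [CompleteSpace H] (C : H →ₗ.[ℂ] H) (hC : IsSelfAdjoint C)
    (U : ℝ → H →L[ℂ] H) (h0 : U 0 = 1)
    (hsg : ∀ s t : ℝ, U (s + t) = (U s).comp (U t)) (hiso : ∀ (t : ℝ) (v : H), ‖U t v‖ = ‖v‖)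
    (hgen : ∀ x : C.domain, HasDerivAt (fun t : ℝ => U t (x : H)) (Complex.I • C x) 0)
    (g : C.domain) (s : ℝ) : (U s (g : H), U s (C g)) ∈ C.graph := by
  have key : ∀ z : C.domain, inner ℂ (U s (C g)) (z : H) = inner ℂ (U s (g : H)) (C z) := by
    intro z
    have d1 : HasDerivAt (fun τ : ℝ => inner ℂ (U s (g : H)) (U τ (z : H)))
        (inner ℂ (U s (g : H)) (Complex.I • C z)) 0 := by
      have := (hasDerivAt_const (0 : ℝ) (U s (g : H))).inner ℂ (hgen z)
      simpa only [inner_zero_left, add_zero] using this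
    have d2 : HasDerivAt (fun τ : ℝ => inner ℂ (U (s - τ) (g : H)) (z : H))
        (inner ℂ (-(U s (Complex.I • C g))) (z : H)) 0 := by
      have e := trot_group_deriv U hsg _ _ (hgen g) s
      have e2 : HasDerivAt (fun τ : ℝ => U (s - τ) (g : H)) (-(U s (Complex.I • C g))) 0 := by
        exact HasDerivAt.comp_const_sub s 0 (f := fun t : ℝ => U t (g : H)) (by simpa using e)
      have := e2.inner ℂ (hasDerivAt_const (0 : ℝ) (z : H))
      simpa using this
    have e : (fun τ : ℝ => inner ℂ (U s (g : H)) (U τ (z : H)))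
        = fun τ : ℝ => inner ℂ (U (s - τ) (g : H)) (z : H) := by
      funext τ
      rw [← trot_group_adj U h0 hsg hiso, ← ContinuousLinearMap.comp_apply, ← hsg,
        neg_add_eq_sub]
    rw [e] at d1
    have h := d1.unique d2
    rw [map_smul, inner_smul_right, inner_neg_left, inner_smul_left, Complex.conj_I,
      neg_mul, neg_neg] at h
    exact (mul_left_cancel₀ Complex.I_ne_zero h).symm
  have hC' := LinearPMap.isSelfAdjoint_def.1 hC
  have hm : U s (g : H) ∈ C.adjoint.domain :=
    LinearPMap.mem_adjoint_domain_of_exists _ ⟨U s (C g), key⟩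
  have hv := LinearPMap.adjoint_apply_eq hC.dense_domain ⟨_, hm⟩ key
  have := C.adjoint.mem_graph ⟨_, hm⟩
  rw [hv] at this
  have hg : C.adjoint.graph = C.graph := by rw [hC']
  rw [hg] at this
  exact this

end TrotterGroup

/-- Trotter product formula: if `A`, `B` are self-adjoint operators such that `A + B`
(defined on `D(A) ∩ D(B)`) is essentially self-adjoint, and `UA`, `UB`, `UC` are the
unitary one-parameter groups generated by `A`, `B` and `cl(A+B)` respectively, then for
every `f` and `t`, `(e^{itA/n} e^{itB/n})^n f → e^{it·cl(A+B)} f` as `n → ∞`. -/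
theorem stmt_8 {H : Type*} [NormedAddCommGroup H] [InnerProductSpace ℂ H] [CompleteSpace H]
    (A B : H →ₗ.[ℂ] H) (hA : IsSelfAdjoint A) (hB : IsSelfAdjoint B)
    (hclosable : (A + B).IsClosable)
    (hess : IsSelfAdjoint (A + B).closure)
    (UA UB UC : ℝ → H →L[ℂ] H)
    (hUA0 : UA 0 = 1) (hUB0 : UB 0 = 1) (hUC0 : UC 0 = 1)
    (hUAsg : ∀ s t : ℝ, UA (s + t) = (UA s).comp (UA t))
    (hUBsg : ∀ s t : ℝ, UB (s + t) = (UB s).comp (UB t))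
    (hUCsg : ∀ s t : ℝ, UC (s + t) = (UC s).comp (UC t))
    (hUAiso : ∀ (t : ℝ) (v : H), ‖UA t v‖ = ‖v‖)
    (hUBiso : ∀ (t : ℝ) (v : H), ‖UB t v‖ = ‖v‖)
    (hUCiso : ∀ (t : ℝ) (v : H), ‖UC t v‖ = ‖v‖)
    (hUAcont : ∀ v : H, Continuous fun t => UA t v)
    (hUBcont : ∀ v : H, Continuous fun t => UB t v)
    (hUCcont : ∀ v : H, Continuous fun t => UC t v)
    (hUAgen : ∀ x : A.domain,
      HasDerivAt (fun t : ℝ => UA t (x : H)) (Complex.I • A x) 0)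
    (hUBgen : ∀ x : B.domain,
      HasDerivAt (fun t : ℝ => UB t (x : H)) (Complex.I • B x) 0)
    (hUCgen : ∀ x : (A + B).closure.domain,
      HasDerivAt (fun t : ℝ => UC t (x : H)) (Complex.I • (A + B).closure x) 0) :
    ∀ (f : H) (t : ℝ),
      Filter.Tendsto (fun n : ℕ => (((UA (t / n)).comp (UB (t / n))) ^ n) f)
        Filter.atTop (nhds (UC t f)) := by
  intro f t
  set C := (A + B).closure with hCdef
  -- pairs of a vector and the limit of its scaled increments
  let S : Set (H × H) := (fun p : H × H => (p.1, (-t) • (Complex.I • p.2))) '' ((A + B).graph : Set (H × H))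
  let F : ℕ → H →L[ℂ] H := fun n => (UA (t / n)).comp (UB (t / n))
  let F' : ℕ → H →L[ℂ] H := fun n => (UB (-(t / n))).comp (UA (-(t / n)))
  have hF : ∀ n x, ‖F n x‖ = ‖x‖ := fun n x => by
    simp only [F, ContinuousLinearMap.comp_apply, hUAiso, hUBiso]
  have hadj : ∀ n x y, inner ℂ (F' n x) y = inner ℂ x (F n y) := fun n x y => by
    simp only [F, F', ContinuousLinearMap.comp_apply]
    rw [trot_group_adj UB hUB0 hUBsg hUBiso, trot_group_adj UA hUA0 hUAsg hUAiso]
  have hS : ∀ p ∈ S, Tendsto (fun n : ℕ => (n : ℝ) • (F' n p.1 - p.1)) atTop (𝓝 p.2) := by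
    rintro _ ⟨p, hp, rfl⟩
    obtain ⟨y, hy1, hy2⟩ := (LinearPMap.mem_graph_iff _).1 hp
    have hyA : (y : H) ∈ A.domain := y.2.1
    have hyB : (y : H) ∈ B.domain := y.2.2
    have h := trot_prod UA UB hUA0 hUB0 hUBiso hUBcont (y : H) _ _ (hUAgen ⟨y, hyA⟩)
      (hUBgen ⟨y, hyB⟩) t
    rw [← smul_add] at h
    have e : A ⟨y, hyA⟩ + B ⟨y, hyB⟩ = p.2 := by rw [← hy2]; rfl
    rw [e, hy1] at h
    exact h
  have hcl : closure ((A + B).graph : Set (H × H)) = (C.graph : Set (H × H)) := by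
    rw [← hclosable.graph_closure_eq_closure_graph]; rfl
  have hmemS : ∀ p ∈ C.graph, (p.1, (-t) • (Complex.I • p.2)) ∈ closure S := by
    intro p hp
    have hp' : p ∈ closure ((A + B).graph : Set (H × H)) := by rw [hcl]; exact hp
    have hc : Continuous (fun p : H × H => (p.1, (-t) • (Complex.I • p.2))) := by fun_prop
    exact image_closure_subset_closure_image hc ⟨p, hp', rfl⟩
  have hd : Dense (Prod.fst '' S) := by
    have h1 : (C.domain : Set H) ⊆ closure (Prod.fst '' S) := by
      intro g hg
      exact image_closure_subset_closure_image continuous_fst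
        ⟨_, hmemS _ (C.mem_graph ⟨g, hg⟩), rfl⟩
    have h2 := hess.dense_domain.closure_eq
    have h3 := closure_minimal h1 isClosed_closure
    rw [h2] at h3
    exact fun g => h3 (mem_univ g)
  have weak0 : ∀ g : C.domain, Tendsto (fun n => inner ℂ (UC t (g : H)) ((F n ^ n) f)) atTop
      (𝓝 (inner ℂ (g : H) f)) := by
    intro g
    have h := trot_core F F' hF hadj S hS hd (fun s => UC (t * s) (g : H))
      (fun s => t • UC (t * s) (Complex.I • C g)) (fun s => by
        have h1 := trot_group_deriv UC hUCsg _ _ (hUCgen g) (t * s)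
        have hm : HasDerivAt (fun τ : ℝ => t * τ) t s := by
          simpa using (hasDerivAt_id s).const_mul t
        exact HasDerivAt.scomp s (h := fun τ : ℝ => t * τ) h1 hm) (fun s => by
        have h1 := hmemS _ (trot_invariant C hess UC hUC0 hUCsg hUCiso hUCgen g (t * s))
        simpa using h1) f
    simpa [hUC0] using h
  have weak : ∀ g : H, Tendsto (fun n => inner ℂ (UC t g) ((F n ^ n) f)) atTop
      (𝓝 (inner ℂ g f)) := by
    intro g
    rw [Metric.tendsto_atTop]
    intro ε hε
    obtain ⟨g', hg', hgd⟩ := Metric.mem_closure_iff.1 (hess.dense_domain g)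
      (ε / (3 * (‖f‖ + 1))) (by positivity)
    rw [dist_eq_norm] at hgd
    have hsmall : ‖g - g'‖ * ‖f‖ ≤ ε / 3 := by
      rw [lt_div_iff₀ (by positivity)] at hgd
      nlinarith [norm_nonneg (g - g')]
    obtain ⟨N, hN⟩ := Metric.tendsto_atTop.1 (weak0 ⟨g', hg'⟩) (ε / 3) (by positivity)
    refine ⟨N, fun n hn => ?_⟩
    have h1 := hN n hn
    rw [dist_eq_norm] at h1 ⊢
    have e : inner ℂ (UC t g) ((F n ^ n) f) - inner ℂ g f
        = inner ℂ (UC t (g - g')) ((F n ^ n) f)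
          + (inner ℂ (UC t g') ((F n ^ n) f) - inner ℂ g' f) - inner ℂ (g - g') f := by
      rw [map_sub, inner_sub_left, inner_sub_left]; ring
    have h2 := norm_inner_le_norm (𝕜 := ℂ) (UC t (g - g')) ((F n ^ n) f)
    rw [hUCiso, trot_pow_norm _ (hF n)] at h2
    have h3 := norm_inner_le_norm (𝕜 := ℂ) (g - g') f
    rw [e]
    refine lt_of_le_of_lt ((norm_sub_le _ _).trans (add_le_add (norm_add_le _ _) le_rfl)) ?_
    linarith
  change Tendsto (fun n => (F n ^ n) f) atTop (𝓝 (UC t f))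
  have hre : Tendsto (fun n => RCLike.re (inner ℂ (UC t f) ((F n ^ n) f))) atTop
      (𝓝 (‖f‖ ^ 2)) := by
    have := (RCLike.continuous_re (K := ℂ)).tendsto _ |>.comp (weak f)
    rw [inner_self_eq_norm_sq] at this
    exact this
  have hsq : Tendsto (fun n => ‖(F n ^ n) f - UC t f‖ ^ 2) atTop (𝓝 0) := by
    have h := (hre.const_mul 2).const_sub (2 * ‖f‖ ^ 2)
    rw [sub_self] at h
    refine h.congr fun n => ?_
    rw [norm_sub_rev, norm_sub_sq (𝕜 := ℂ), trot_pow_norm _ (hF n), hUCiso]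
    ring
  rw [tendsto_iff_norm_sub_tendsto_zero]
  have h := (Real.continuous_sqrt.tendsto _).comp hsq
  rw [Real.sqrt_zero] at h
  refine h.congr fun n => ?_
  simp [Real.sqrt_sq (norm_nonneg _)]
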